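/- arXiv:0903.4326 — 3 statements merged into one kernel-verified Lean document; each statement's English description precedes it below -/
import Mathlib

section
/- Let n ≥ 1 and let φ be an n×n matrix over a field of characteristic zero. Write the characteristic polynomial χ(x) = det(x·I − φ) = x^n + λ_{n−1}x^{n−1} + ⋯ + λ_1 x + λ_0. Then for every ℓ with 1 ≤ ℓ ≤ n, λ_{n−ℓ} = Σ_p (−1)^{r(p)} · α_p · tr(φ^{p_1})·tr(φ^{p_2})⋯tr(φ^{p_r}), where the sum is over all partitions p = (p_1, …, p_r) of ℓ, r(p) = r is the number of parts of p, and α_p = (1/(p_1 p_2 ⋯ p_r)) · ∏_{a≥1} 1/(m_a!), with m_a the number of parts of p equal to a. -/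
open Matrix Finset

namespace Matrix

open Polynomial

variable {m R : Type*} [Fintype m] [DecidableEq m] [CommRing R]

/-- Jacobi's formula for the derivative of the determinant of a matrix of polynomials. -/
theorem derivative_det_eq_trace_adjugate_mul (N : Matrix m m R[X]) :
    derivative N.det = trace (N.adjugate * N.map derivative) := by
  have h (i : m) : (N.adjugate * N.map derivative) i i =
      (N.updateCol i fun j => derivative (N j i)).det := by
    rw [← cramer_apply, cramer_eq_adjugate_mulVec]
    rfl
  simp only [trace, diag_apply, h, det_apply', map_sum]
  rw [Finset.sum_comm]
  refine Finset.sum_congr rfl fun σ _ => ?_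
  rw [← Finset.mul_sum, derivative_intCast_mul, derivative_prod_finset]
  congr 1
  refine Finset.sum_congr rfl fun i _ => ?_
  rw [← Finset.prod_erase_mul _ _ (Finset.mem_univ i), updateCol_self]
  congr 1
  refine Finset.prod_congr rfl fun j hj => ?_
  rw [updateCol_ne (Finset.ne_of_mem_erase hj)]

/-- The coefficients of the adjugate of `1 - X • M` in terms of powers of `M`. -/
theorem map_coeff_adjugate_one_sub_X_smul (M : Matrix m m R) (k : ℕ) :
    (1 - (X : R[X]) • M.map C).adjugate.map (coeff · k) =
      ∑ i ∈ range (k + 1), M.charpolyRev.coeff (k - i) • M ^ i := by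
  set B := (1 - (X : R[X]) • M.map C).adjugate
  have h : B - (X : R[X]) • (B * M.map C) = M.charpolyRev • (1 : Matrix m m R[X]) := by
    rw [charpolyRev, ← adjugate_mul, mul_sub, mul_one, mul_smul_comm]
  have hmul (k : ℕ) : (B * M.map C).map (coeff · k) = B.map (coeff · k) * M := by
    ext i j
    simp [mul_apply, finsetSum_coeff]
  have hone (k : ℕ) : (M.charpolyRev • (1 : Matrix m m R[X])).map (coeff · k) =
      M.charpolyRev.coeff k • (1 : Matrix m m R) := by
    ext i j
    rcases eq_or_ne i j with rfl | hij <;> simp [*]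
  rw [sub_eq_iff_eq_add] at h
  induction k with
  | zero =>
    have := congrArg (fun A => A.map (coeff · 0)) h
    rw [zero_add, this, Finset.sum_range_one, pow_zero, ← hone]
    ext i j
    simp
  | succ k ih =>
    have := congrArg (fun A => A.map (coeff · (k + 1))) h
    have h2 : (M.charpolyRev • (1 : Matrix m m R[X]) + (X : R[X]) • (B * M.map C)).map
        (coeff · (k + 1)) = (M.charpolyRev • (1 : Matrix m m R[X])).map (coeff · (k + 1)) +
          (B * M.map C).map (coeff · k) := by
      ext i j
      simp only [map_apply, add_apply, smul_apply X, smul_eq_mul, coeff_add, coeff_X_mul]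
    rw [this, h2, hone, hmul, ih, Finset.sum_range_succ' _ (k + 1), add_comm, Finset.sum_mul]
    simp [pow_succ]

/-- Newton's identities for the characteristic polynomial of a matrix. -/
theorem succ_mul_coeff_charpolyRev (M : Matrix m m R) (k : ℕ) :
    ((k + 1 : ℕ) : R) * M.charpolyRev.coeff (k + 1) =
      -∑ i ∈ range (k + 1), trace (M ^ (i + 1)) * M.charpolyRev.coeff (k - i) := by
  have hder : (1 - (X : R[X]) • M.map C).map derivative = -M.map C := by
    ext i j : 2
    rcases eq_or_ne i j with rfl | hij <;> simp [*]
  have h := congrArg (coeff · k) (derivative_det_eq_trace_adjugate_mul (1 - (X : R[X]) • M.map C))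
  simp only [hder, coeff_derivative] at h
  rw [mul_comm, Nat.cast_succ, charpolyRev, h, mul_neg, trace_neg, coeff_neg]
  have htr : (trace ((1 - (X : R[X]) • M.map C).adjugate * M.map C)).coeff k =
      trace ((1 - (X : R[X]) • M.map C).adjugate.map (coeff · k) * M) := by
    simp [trace, mul_apply, finsetSum_coeff]
  rw [htr, map_coeff_adjugate_one_sub_X_smul, Finset.sum_mul, trace_sum]
  simp [pow_succ, mul_comm, charpolyRev]

/-- The coefficient of the reverse characteristic polynomial as a coefficient of the
characteristic polynomial. -/
theorem coeff_charpoly_card_sub [Nontrivial R] (M : Matrix m m R) {k : ℕ}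
    (hk : k ≤ Fintype.card m) :
    M.charpoly.coeff (Fintype.card m - k) = M.charpolyRev.coeff k := by
  rw [← reverse_charpoly, coeff_reverse, charpoly_natDegree_eq_dim, revAt_le hk]

end Matrix

namespace Nat.Partition

variable {K : Type*} [Field K]

/-- The monomial `∏ i ∈ s, t i` weighted by the signed inverse of the order of the centralizer of a
permutation of cycle type `s`. -/
def waringTerm (t : ℕ → K) (s : Multiset ℕ) : K :=
  (-1 : K) ^ (Multiset.card s) *
    ((s.map (fun i : ℕ => (i : K))).prod)⁻¹ *
    (∏ a ∈ s.toFinset, ((Nat.factorial (s.count a) : K)))⁻¹ *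
    (s.map t).prod

theorem prod_factorial_count_cons (a : ℕ) (s : Multiset ℕ) :
    ∏ b ∈ (a ::ₘ s).toFinset, ((a ::ₘ s).count b).factorial =
      (s.count a + 1) * ∏ b ∈ s.toFinset, (s.count b).factorial := by
  have h : ∏ b ∈ s.toFinset, (s.count b).factorial =
      ∏ b ∈ insert a s.toFinset, (s.count b).factorial := by
    refine Finset.prod_subset (Finset.subset_insert _ _) fun b _ hb => ?_
    rw [Multiset.count_eq_zero_of_notMem (by simpa using hb), Nat.factorial_zero]
  rw [h, Multiset.toFinset_cons, ← Finset.mul_prod_erase _ _ (Finset.mem_insert_self a _),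
    ← Finset.mul_prod_erase _ (fun b => (s.count b).factorial) (Finset.mem_insert_self a _),
    Multiset.count_cons_self, Nat.factorial_succ, mul_assoc]
  congr 2
  refine Finset.prod_congr rfl fun b hb => ?_
  rw [Multiset.count_cons_of_ne (Finset.ne_of_mem_erase hb)]

variable [CharZero K]

theorem mul_waringTerm_cons (t : ℕ → K) {a : ℕ} (ha : a ≠ 0) (s : Multiset ℕ) :
    (((a ::ₘ s).count a * a : ℕ) : K) * waringTerm t (a ::ₘ s) = -(t a * waringTerm t s) := by
  have h := congrArg (Nat.cast : ℕ → K) (prod_factorial_count_cons a s)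
  push_cast at h
  have ha' : (a : K) ≠ 0 := mod_cast ha
  have hc : (s.count a + 1 : K) ≠ 0 := mod_cast (s.count a).succ_ne_zero
  simp only [waringTerm, h, Multiset.card_cons, Multiset.map_cons, Multiset.prod_cons, mul_inv,
    pow_succ, Multiset.count_cons_self]
  push_cast
  field_simp

theorem mul_sum_waringTerm (t : ℕ → K) (k : ℕ) :
    (k : K) * ∑ p : Nat.Partition k, waringTerm t p.parts =
      -∑ a ∈ Icc 1 k, t a * ∑ q : Nat.Partition (k - a), waringTerm t q.parts := by
  have hp (p : Nat.Partition k) : (k : K) * waringTerm t p.parts =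
      ∑ a ∈ Icc 1 k, if a ∈ p.parts then -(t a * waringTerm t (p.parts.erase a)) else 0 := by
    rw [← Finset.sum_filter]
    have hf : (Icc 1 k).filter (· ∈ p.parts) = p.parts.toFinset := by
      ext a
      simp only [mem_filter, mem_Icc, Multiset.mem_toFinset, and_iff_right_iff_imp]
      exact fun h => ⟨p.parts_pos h, p.le_of_mem_parts h⟩
    have hk : (k : K) = ∑ a ∈ p.parts.toFinset, ((p.parts.count a * a : ℕ) : K) := by
      conv_lhs => rw [← p.parts_sum, Finset.sum_multiset_count]
      simp
    rw [hf, hk, Finset.sum_mul]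
    refine Finset.sum_congr rfl fun a ha => ?_
    rw [Multiset.mem_toFinset] at ha
    have := mul_waringTerm_cons t (p.parts_pos ha).ne' (p.parts.erase a)
    rwa [Multiset.cons_erase ha] at this
  simp only [Finset.mul_sum, hp, ← Finset.sum_neg_distrib]
  rw [Finset.sum_comm]
  refine Finset.sum_congr rfl fun a ha => ?_
  rw [mem_Icc] at ha
  rw [← Finset.sum_filter, ← Finset.sum_subtype_eq_sum_filter, Finset.subtype_univ,
    ← (partitionWithPartEquiv ha.1 ha.2).sum_comp]
  simp

end Nat.Partition

/-- The coefficients of the reverse characteristic polynomial in terms of traces of powers. -/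
theorem Matrix.coeff_charpolyRev_eq_sum_waringTerm {m K : Type*} [Fintype m] [DecidableEq m]
    [Field K] [CharZero K] (M : Matrix m m K) (k : ℕ) :
    M.charpolyRev.coeff k =
      ∑ p : Nat.Partition k, Nat.Partition.waringTerm (fun i => trace (M ^ i)) p.parts := by
  induction k using Nat.strong_induction_on with
  | _ k ih =>
    cases k with
    | zero =>
      rw [Polynomial.coeff_zero_eq_eval_zero, eval_charpolyRev]
      simp [Nat.Partition.waringTerm]
    | succ k =>
      have hk : ((k + 1 : ℕ) : K) ≠ 0 := Nat.cast_ne_zero.2 k.succ_ne_zero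
      refine mul_left_cancel₀ hk ?_
      rw [succ_mul_coeff_charpolyRev, Nat.Partition.mul_sum_waringTerm, neg_inj,
        ← Finset.Ico_add_one_right_eq_Icc, Finset.sum_Ico_eq_sum_range]
      refine Finset.sum_congr rfl fun i _ => ?_
      rw [ih _ (by lia), add_comm 1 i, Nat.add_sub_add_right]



/-- Waring-type formula: the coefficients of the characteristic polynomial
`χ(x) = det(x·I − φ)` of an `n × n` matrix `φ` over a field of characteristic zero
are given in terms of traces of powers of `φ` by a sum over the partitions of `ℓ`. -/
theorem coeff_charpoly_eq_sum_partitions {K : Type*} [Field K] [CharZero K]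
    (n : ℕ) (hn : 1 ≤ n) (φ : Matrix (Fin n) (Fin n) K)
    (ℓ : ℕ) (hℓ₁ : 1 ≤ ℓ) (hℓ₂ : ℓ ≤ n) :
    (Matrix.charpoly φ).coeff (n - ℓ) =
      ∑ p : Nat.Partition ℓ,
        (-1 : K) ^ (Multiset.card p.parts) *
          ((p.parts.map (fun i : ℕ => (i : K))).prod)⁻¹ *
          (∏ a ∈ p.parts.toFinset, ((Nat.factorial (p.parts.count a) : K)))⁻¹ *
          (p.parts.map (fun i => Matrix.trace (φ ^ i))).prod := by
  have h := Matrix.coeff_charpoly_card_sub φ (k := ℓ) (by simpa using hℓ₂)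
  rw [Fintype.card_fin] at h
  rw [h, Matrix.coeff_charpolyRev_eq_sum_waringTerm]
  rfl
end

section
/- Let c ≥ 5 be an integer and set n = c + 4. Let Φ be the (n+1)×(n+1) = (c+5)×(c+5) integer matrix in block form with row/column blocks of sizes 1, 1, 2, c, 1 defined as follows: the (1,1) entry is 0; the rest of the first row is (−(v_1 − ε_1^{(1)}), −(v_2 − ε_2^{(2)}), −(v_c − ε_c^{(c)}), −1) = (0, −1, 0, −(v_c − ε_c^{(c)}), −1); the rest of the first column is ((ε_1^{(1)})ᵀ, (ε_1^{(2)})ᵀ, (ε_1^{(c)})ᵀ, −2); and the remaining (c+4)×(c+4) block is φ = [[J_1, K_{1,2}, K_{1,c}, K_{1,1}], [K_{2,1}, J_2, K_{2,c}, K_{2,1}], [K_{c,1}, K_{c,2}, J_c, K_{c,1}], [−K_{1,1}, −K_{1,2}, −K_{1,c}, −1]]. Write the characteristic polynomial det(x·I − Φ) = Σ_{i=0}^{n+1} λ_i x^i. Then λ_{n−1} = 0, λ_{n−2} = −1, λ_{n−3} = −1 and λ_{n−4} = 0. -/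
open Matrix Finset

/-- `J_p`: the `p × p` matrix with 1's in positions `(i+1, i)` and 0 elsewhere
(0-indexed: entry `(i, j)` is 1 iff `i = j + 1`). -/
def Jmat (p : ℕ) : Matrix (Fin p) (Fin p) ℤ :=
  Matrix.of fun i j => if (i : ℕ) = (j : ℕ) + 1 then 1 else 0

/-- `K_{p,q}`: the `p × q` matrix whose first row consists of 1's, other entries 0. -/
def Kmat (p q : ℕ) : Matrix (Fin p) (Fin q) ℤ :=
  Matrix.of fun i _ => if (i : ℕ) = 0 then 1 else 0

/-- The Coxeter matrix of (the path algebra of) the star tree `T_{a,b,c}`, in block form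
with row/column blocks of sizes `a, b, c, 1`:
`φ = [[J_a, K_{a,b}, K_{a,c}, K_{a,1}], [K_{b,a}, J_b, K_{b,c}, K_{b,1}],
[K_{c,a}, K_{c,b}, J_c, K_{c,1}], [−K_{1,a}, −K_{1,b}, −K_{1,c}, −1]]`. -/
def starCoxeter (a b c : ℕ) :
    Matrix ((Fin a ⊕ Fin b) ⊕ (Fin c ⊕ Fin 1)) ((Fin a ⊕ Fin b) ⊕ (Fin c ⊕ Fin 1)) ℤ :=
  Matrix.fromBlocks
    (Matrix.fromBlocks (Jmat a) (Kmat a b) (Kmat b a) (Jmat b))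
    (Matrix.fromBlocks (Kmat a c) (Kmat a 1) (Kmat b c) (Kmat b 1))
    (Matrix.fromBlocks (Kmat c a) (Kmat c b) (-(Kmat 1 a)) (-(Kmat 1 b)))
    (Matrix.fromBlocks (Jmat c) (Kmat c 1) (-(Kmat 1 c)) (-1))

/-- The Coxeter matrix `Φ` of the canonical algebra `C_{a,b,c}`, in block form
with row/column blocks of sizes `1, a, b, c, 1`: the `(1,1)` entry is `0`; the rest of
the first row is `(−(v_a − ε_a^{(a)}), −(v_b − ε_b^{(b)}), −(v_c − ε_c^{(c)}), −1)`;
the rest of the first column is `((ε_1^{(a)})ᵀ, (ε_1^{(b)})ᵀ, (ε_1^{(c)})ᵀ, −2)`; and the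
remaining `(a+b+c+1) × (a+b+c+1)` block is the Coxeter matrix of the star tree
`T_{a,b,c}`. (0-indexed: `ε_p^{(p)}` has its 1 at index `p − 1`, `ε_1^{(p)}` at index 0.) -/
def canonicalCoxeter (a b c : ℕ) :
    Matrix (Fin 1 ⊕ ((Fin a ⊕ Fin b) ⊕ (Fin c ⊕ Fin 1)))
      (Fin 1 ⊕ ((Fin a ⊕ Fin b) ⊕ (Fin c ⊕ Fin 1))) ℤ :=
  Matrix.fromBlocks
    (0 : Matrix (Fin 1) (Fin 1) ℤ)
    (Matrix.of fun _ j =>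
      Sum.elim
        (Sum.elim (fun i : Fin a => (if (i : ℕ) = a - 1 then 1 else 0) - 1)
          (fun i : Fin b => (if (i : ℕ) = b - 1 then 1 else 0) - 1))
        (Sum.elim (fun i : Fin c => (if (i : ℕ) = c - 1 then 1 else 0) - 1)
          (fun _ : Fin 1 => -1)) j)
    (Matrix.of fun i _ =>
      Sum.elim
        (Sum.elim (fun i : Fin a => if (i : ℕ) = 0 then 1 else 0)
          (fun i : Fin b => if (i : ℕ) = 0 then 1 else 0))
        (Sum.elim (fun i : Fin c => if (i : ℕ) = 0 then 1 else 0)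
          (fun _ : Fin 1 => -2)) i)
    (starCoxeter a b c)

/-- Splitting off the columns below a lower right block `D` when `D * X = C`. -/
lemma det_fromBlocks_of_mul_eq {m n R : Type*} [CommRing R] [Fintype m] [Fintype n]
    [DecidableEq m] [DecidableEq n] (A : Matrix m m R) (B : Matrix m n R) (C : Matrix n m R)
    (D : Matrix n n R) (X : Matrix n m R) (hX : D * X = C) :
    (Matrix.fromBlocks A B C D).det = (A - B * X).det * D.det := by
  have h : Matrix.fromBlocks A B C D * Matrix.fromBlocks 1 0 (-X) 1 =
      Matrix.fromBlocks (A - B * X) B 0 D := by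
    simp [Matrix.fromBlocks_multiply, hX, sub_eq_add_neg]
  have h' := congrArg Matrix.det h
  rwa [Matrix.det_mul, Matrix.det_fromBlocks_zero₁₂, Matrix.det_fromBlocks_zero₂₁,
    Matrix.det_one, Matrix.det_one, mul_one, mul_one] at h'

/-- The index set of `canonicalCoxeter 1 2 c`, with the indices of the long arm moved to the end. -/
def longArmEquiv (c : ℕ) : Fin 5 ⊕ Fin c ≃ Fin 1 ⊕ ((Fin 1 ⊕ Fin 2) ⊕ (Fin c ⊕ Fin 1)) where
  toFun := Sum.elim
    ![.inl 0, .inr (.inl (.inl 0)), .inr (.inl (.inr 0)), .inr (.inl (.inr 1)),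
      .inr (.inr (.inr 0))]
    fun i => .inr (.inr (.inl i))
  invFun := Sum.elim (fun _ => .inl 0)
    (Sum.elim (Sum.elim (fun _ => .inl 1) ![.inl 2, .inl 3])
      (Sum.elim .inr fun _ => .inl 4))
  left_inv := by
    rintro (i | i)
    · fin_cases i <;> rfl
    · rfl
  right_inv := by
    rintro (i | (i | i) | i | i)
    · fin_cases i; rfl
    · fin_cases i; rfl
    · fin_cases i <;> rfl
    · rfl
    · fin_cases i; rfl

lemma scalar_sub_canonicalCoxeter_submatrix (c : ℕ) (t : ℚ) :
    (Matrix.scalar _ t - (canonicalCoxeter 1 2 c).map (Int.cast : ℤ → ℚ)).submatrix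
        (longArmEquiv c) (longArmEquiv c) =
      Matrix.fromBlocks
        !![t, 0, 1, 0, 1; -1, t, -1, -1, -1; -1, -1, t, 0, -1; 0, 0, -1, t, 0; 2, 1, 1, 1, t + 1]
        (Matrix.of ![fun j : Fin c => 1 - if (j : ℕ) = c - 1 then 1 else 0, fun _ => -1,
          fun _ => -1, fun _ => 0, fun _ => 1])
        (Matrix.of fun (i : Fin c) _ => if (i : ℕ) = 0 then -1 else 0)
        (Matrix.scalar _ t - (Jmat c).map (Int.cast : ℤ → ℚ)) := by
  ext (i | i) (j | j)
  · fin_cases i <;> fin_cases j <;>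
      simp [longArmEquiv, canonicalCoxeter, starCoxeter, Jmat, Kmat]
  · fin_cases i <;>
      simp [longArmEquiv, canonicalCoxeter, starCoxeter, Jmat, Kmat]
  · fin_cases j <;>
      simp [longArmEquiv, canonicalCoxeter, starCoxeter, Jmat, Kmat]
      <;> split_ifs <;> simp
  · simp [longArmEquiv, canonicalCoxeter, starCoxeter, Matrix.diagonal_apply]

lemma det_scalar_sub_Jmat (c : ℕ) (t : ℚ) :
    (Matrix.scalar _ t - (Jmat c).map (Int.cast : ℤ → ℚ)).det = t ^ c := by
  rw [Matrix.det_of_isLowerTriangular]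
  · simp [Jmat]
  · intro i j hij
    have hlt : i < j := hij
    simp [Jmat, hlt.ne]
    omega

/-- The first column of `(t - J)⁻¹` solves `(t - J) u = ε₁`. -/
lemma scalar_sub_Jmat_mul (c : ℕ) {t : ℚ} (ht : t ≠ 0) :
    (Matrix.scalar _ t - (Jmat c).map (Int.cast : ℤ → ℚ)) *
        (Matrix.of fun (i : Fin c) (_ : Fin 5) => -(t⁻¹ ^ ((i : ℕ) + 1))) =
      Matrix.of fun (i : Fin c) _ => if (i : ℕ) = 0 then -1 else 0 := by
  ext i j
  rw [Matrix.sub_mul, Matrix.sub_apply, Matrix.scalar_apply, Matrix.diagonal_mul, Matrix.mul_apply]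
  obtain ⟨_ | k, hk⟩ := i
  · simp [Jmat, ht]
  · rw [Finset.sum_eq_single ⟨k, by omega⟩]
    · simp [Jmat]
      field_simp
      ring
    · intro b _ hb
      have : k ≠ (b : ℕ) := fun h => hb (Fin.ext h.symm)
      simp [Jmat, this]
    · simp

open Polynomial in
/-- The Coxeter polynomial of the canonical algebra with weights `(2, 3, c + 1)`. -/
lemma charpoly_canonicalCoxeter_one_two {c : ℕ} (hc : 0 < c) :
    (canonicalCoxeter 1 2 c).charpoly = (X + 1) * (X ^ 3 - 1) * (X ^ (c + 1) - 1) := by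
  apply Polynomial.map_injective (Int.castRingHom ℚ) Int.cast_injective
  rw [← Matrix.charpoly_map]
  apply Polynomial.eq_of_infinite_eval_eq
  refine (Set.finite_singleton (0 : ℚ)).infinite_compl.mono fun t ht => ?_
  have ht : t ≠ 0 := ht
  have hlast : ∑ i : Fin c, (1 - if (i : ℕ) = c - 1 then (1 : ℚ) else 0) * t⁻¹ ^ ((i : ℕ) + 1) =
      ∑ i : Fin c, t⁻¹ ^ ((i : ℕ) + 1) - t⁻¹ ^ c := by
    simp_rw [sub_mul, one_mul, Finset.sum_sub_distrib]
    congr 1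
    rw [Finset.sum_eq_single ⟨c - 1, by omega⟩]
    · simp [Nat.sub_add_cancel hc]
    · intro b _ hb
      have : (b : ℕ) ≠ c - 1 := fun h => hb (Fin.ext h)
      simp [this]
    · simp
  have hA : ∀ s w : ℚ, (!![t, 0, 1, 0, 1; -1, t, -1, -1, -1; -1, -1, t, 0, -1; 0, 0, -1, t, 0;
        2, 1, 1, 1, t + 1] - Matrix.of fun (i _ : Fin 5) => ![-(s - w), s, s, 0, -s] i).det =
      (t + 1) * (t ^ 3 - 1) * (t - w) := by
    intro s w
    have hM : (!![t, 0, 1, 0, 1; -1, t, -1, -1, -1; -1, -1, t, 0, -1; 0, 0, -1, t, 0;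
        2, 1, 1, 1, t + 1] - Matrix.of fun (i _ : Fin 5) => ![-(s - w), s, s, 0, -s] i) =
        !![t - (w - s), s - w, 1 - (w - s), s - w, 1 - (w - s);
          -1 - s, t - s, -1 - s, -1 - s, -1 - s; -1 - s, -1 - s, t - s, -s, -1 - s;
          0, 0, -1, t, 0; 2 + s, 1 + s, 1 + s, 1 + s, t + 1 + s] := by
      ext i j
      fin_cases i <;> fin_cases j <;> simp
    rw [hM, Matrix.det_succ_row _ 3]
    simp [Fin.sum_univ_succ, Fin.succAbove, Matrix.det_succ_row_zero]
    ring
  have hB : (Matrix.of ![fun j : Fin c => 1 - if (j : ℕ) = c - 1 then (1 : ℚ) else 0,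
        fun _ => -1, fun _ => -1, fun _ => 0, fun _ => 1]) *
        (Matrix.of fun (i : Fin c) (_ : Fin 5) => -(t⁻¹ ^ ((i : ℕ) + 1))) =
      Matrix.of fun (i _ : Fin 5) => ![-(∑ i : Fin c, t⁻¹ ^ ((i : ℕ) + 1) - t⁻¹ ^ c),
        ∑ i : Fin c, t⁻¹ ^ ((i : ℕ) + 1), ∑ i : Fin c, t⁻¹ ^ ((i : ℕ) + 1), 0,
        -∑ i : Fin c, t⁻¹ ^ ((i : ℕ) + 1)] i := by
    ext i j
    rw [← hlast]
    fin_cases i <;> simp [Matrix.mul_apply, -inv_pow]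
  have hdet : (Matrix.scalar _ t - (canonicalCoxeter 1 2 c).map (Int.cast : ℤ → ℚ)).det =
      (t + 1) * (t ^ 3 - 1) * (t ^ (c + 1) - 1) := by
    rw [← Matrix.det_submatrix_equiv_self (longArmEquiv c),
      scalar_sub_canonicalCoxeter_submatrix,
      det_fromBlocks_of_mul_eq _ _ _ _ _ (scalar_sub_Jmat_mul c ht), hB, hA,
      det_scalar_sub_Jmat, mul_assoc, sub_mul, ← mul_pow, inv_mul_cancel₀ ht, one_pow, pow_succ' t c]
  simpa [Matrix.eval_charpoly] using hdet

/-- Coefficients of the Coxeter polynomial of the canonical algebra `C_{1,2,c}`, `c ≥ 5`: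
with `n = c + 4` and `det(x·I − Φ) = Σ_i λ_i x^i`,
`λ_{n−1} = 0`, `λ_{n−2} = −1`, `λ_{n−3} = −1` and `λ_{n−4} = 0`. -/
theorem coeff_coxeterPolynomial_canonical_one_two (c : ℕ) (hc : 5 ≤ c) (n : ℕ)
    (hn : n = c + 4) :
    (Matrix.charpoly (canonicalCoxeter 1 2 c)).coeff (n - 1) = 0 ∧
    (Matrix.charpoly (canonicalCoxeter 1 2 c)).coeff (n - 2) = -1 ∧
    (Matrix.charpoly (canonicalCoxeter 1 2 c)).coeff (n - 3) = -1 ∧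
    (Matrix.charpoly (canonicalCoxeter 1 2 c)).coeff (n - 4) = 0 := by
  subst hn
  have hexp : (canonicalCoxeter 1 2 c).charpoly =
      Polynomial.X ^ (c + 5) + Polynomial.X ^ (c + 4) - Polynomial.X ^ (c + 2) -
        Polynomial.X ^ (c + 1) - Polynomial.X ^ 4 - Polynomial.X ^ 3 + Polynomial.X + 1 := by
    rw [charpoly_canonicalCoxeter_one_two (by omega)]
    ring
  rw [hexp]
  refine ⟨?_, ?_, ?_, ?_⟩ <;>
    simp only [Polynomial.coeff_add, Polynomial.coeff_sub, Polynomial.coeff_X_pow,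
      Polynomial.coeff_X, Polynomial.coeff_one] <;>
    repeat' split_ifs <;> omega
end

section
/- Let a, b, c be integers with 2 ≤ a ≤ b ≤ c and set n = a + b + c + 1. Let Φ be the (n+1)×(n+1) integer matrix in block form with row/column blocks of sizes 1, a, b, c, 1 defined as follows: the (1,1) entry is 0; the rest of the first row is (−(v_a − ε_a^{(a)}), −(v_b − ε_b^{(b)}), −(v_c − ε_c^{(c)}), −1); the rest of the first column is ((ε_1^{(a)})ᵀ, (ε_1^{(b)})ᵀ, (ε_1^{(c)})ᵀ, −2); and the remaining (a+b+c+1)×(a+b+c+1) block is φ = [[J_a, K_{a,b}, K_{a,c}, K_{a,1}], [K_{b,a}, J_b, K_{b,c}, K_{b,1}], [K_{c,a}, K_{c,b}, J_c, K_{c,1}], [−K_{1,a}, −K_{1,b}, −K_{1,c}, −1]]. Write the characteristic polynomial det(x·I − Φ) = Σ_{i=0}^{n+1} λ_i x^i. Then λ_{n−r} = 1 for all 1 ≤ r ≤ a−1, and λ_{n−a} = −δ_{ab} − δ_{ac} ≤ 0, where δ_{xy} = 1 if x = y and δ_{xy} = 0 otherwise. -/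
open Matrix Finset

open Polynomial

namespace Matrix

/-- A Schur complement formula that needs no inverse: if `A * U = d • B`, then `d • D - C * U`
is `d` times the Schur complement of `A`. -/
theorem det_fromBlocks_mul_pow {m n R : Type*} [Fintype m] [Fintype n] [DecidableEq m]
    [DecidableEq n] [CommRing R] (A : Matrix m m R) (B : Matrix m n R) (C : Matrix n m R)
    (D : Matrix n n R) (U : Matrix m n R) (d : R) (h : A * U = d • B) :
    (fromBlocks A B C D).det * d ^ Fintype.card n = A.det * (d • D - C * U).det := by
  have hmul : fromBlocks A B C D * fromBlocks 1 (-U) 0 (d • 1) =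
      fromBlocks A 0 C (d • D - C * U) := by
    simp [fromBlocks_multiply, h, sub_eq_neg_add]
  have hdet := congrArg det hmul
  rw [det_mul, det_fromBlocks_zero₂₁, det_fromBlocks_zero₁₂] at hdet
  simpa using hdet

end Matrix

/-- The block `x • 1 - J + e₁ vᵀ` attached to one arm of the star. -/
noncomputable def armMatrix (p : ℕ) : Matrix (Fin p) (Fin p) ℤ[X] :=
  Matrix.of fun i j =>
    (if i = j then X else 0) - (if (i : ℕ) = j + 1 then 1 else 0) + if (i : ℕ) = 0 then 1 else 0

theorem sum_shift_mul (p : ℕ) (i : Fin p) (f : ℕ → ℤ[X]) :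
    ∑ j : Fin p, (if (i : ℕ) = j + 1 then 1 else 0) * f j =
      if (i : ℕ) = 0 then 0 else f (i - 1) := by
  obtain ⟨i, hi⟩ := i
  rw [Fin.sum_univ_eq_sum_range (fun j => (if i = j + 1 then 1 else 0) * f j)]
  cases i with
  | zero => simp
  | succ i =>
    have : i < p := by omega
    simp [this]

theorem sum_armMatrix_mul (p : ℕ) (i : Fin p) (f : ℕ → ℤ[X]) :
    ∑ j, armMatrix p i j * f j =
      X * f i - (if (i : ℕ) = 0 then 0 else f (i - 1)) +
        if (i : ℕ) = 0 then ∑ j : Fin p, f j else 0 := by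
  simp only [armMatrix, Matrix.of_apply, add_mul, sub_mul, Finset.sum_add_distrib,
    Finset.sum_sub_distrib, sum_shift_mul]
  split_ifs <;> simp

theorem sum_pow_rev (p : ℕ) :
    ∑ j : Fin p, (X : ℤ[X]) ^ (p - 1 - (j : ℕ)) = ∑ j ∈ range p, X ^ j := by
  rw [Fin.sum_univ_eq_sum_range (fun j => (X : ℤ[X]) ^ (p - 1 - j)), Finset.sum_range_reflect]

theorem sum_last_mul_pow {p : ℕ} (hp : 0 < p) (q : ℤ[X]) :
    ∑ j : Fin p, (1 - if (j : ℕ) = p - 1 then 1 else 0) * (q * X ^ (p - 1 - (j : ℕ))) =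
      q * (∑ j ∈ range p, X ^ j - 1) := by
  simp only [sub_mul, Finset.sum_sub_distrib, one_mul, ← Finset.mul_sum, sum_pow_rev]
  rw [Fin.sum_univ_eq_sum_range
    fun j => (if j = p - 1 then 1 else 0) * (q * X ^ (p - 1 - j))]
  simp [hp, mul_sub]

theorem armMatrix_mul_pow (p : ℕ) (i : Fin p) :
    ∑ j : Fin p, armMatrix p i j * X ^ (p - 1 - (j : ℕ)) =
      if (i : ℕ) = 0 then ∑ j ∈ range (p + 1), X ^ j else 0 := by
  rw [sum_armMatrix_mul p i fun j => X ^ (p - 1 - j), sum_pow_rev]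
  obtain ⟨i, hi⟩ := i
  rcases Nat.eq_zero_or_pos i with rfl | h
  · simp only [if_true, Finset.sum_range_succ _ p]
    rw [Nat.sub_zero, ← pow_succ', Nat.sub_add_cancel hi]
    ring
  · simp only [h.ne', if_false]
    rw [← pow_succ', show p - 1 - i + 1 = p - 1 - (i - 1) by omega]
    ring

theorem det_armMatrix {p : ℕ} (hp : 0 < p) :
    (armMatrix p).det = ∑ j ∈ range (p + 1), X ^ j := by
  let T : Matrix (Fin p) (Fin p) ℤ[X] :=
    Matrix.of fun i j => if j ≤ i then X ^ (p - 1 - ((i : ℕ) - j)) else 0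
  have hT : T.det = (X ^ (p - 1)) ^ p := by
    rw [Matrix.det_of_isLowerTriangular T]
    · simp [T]
    · intro i j hij
      have : i < j := hij
      simp [T, this]
  have hmul (i j : Fin p) : (armMatrix p * T) i j =
      (if i = j then X ^ p else 0) + if (i : ℕ) = 0 then ∑ k, T k j else 0 := by
    have := sum_armMatrix_mul p i fun k => if (j : ℕ) ≤ k then X ^ (p - 1 - (k - (j : ℕ))) else 0
    simp only [Matrix.mul_apply, T, Matrix.of_apply, Fin.le_def]
    rw [this, add_left_inj]
    obtain ⟨i, hi⟩ := i
    obtain ⟨j, hj⟩ := j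
    simp only [Fin.mk.injEq]
    rcases lt_trichotomy i j with h | rfl | h
    · simp [h.ne, h.not_ge, show ¬ j ≤ i - 1 by omega]
    · rcases Nat.eq_zero_or_pos i with rfl | h
      · simp [← pow_succ', Nat.sub_add_cancel hp]
      · simp [h.ne', show ¬ i ≤ i - 1 by omega, ← pow_succ', Nat.sub_add_cancel hp]
    · simp only [h.le, if_true, show i ≠ 0 by omega, if_false, show j ≤ i - 1 by omega, h.ne']
      rw [← pow_succ', show p - 1 - (i - j) + 1 = p - 1 - (i - 1 - j) by omega, sub_self]
  have hdet : (armMatrix p * T).det =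
      (∑ j ∈ range (p + 1), X ^ j) * (X ^ p) ^ (p - 1) := by
    rw [Matrix.det_of_isUpperTriangular]
    · obtain ⟨q, rfl⟩ := Nat.exists_eq_succ_of_ne_zero hp.ne'
      rw [Fin.prod_univ_succ]
      simp only [hmul]
      have := sum_pow_rev (q + 1)
      simp [T] at this ⊢
      rw [this, Finset.sum_range_succ _ (q + 1)]
      ring
    · intro i j hij
      have h : j < i := hij
      have h0 : (i : ℕ) ≠ 0 := by have := Fin.lt_def.mp h; omega
      simp [hmul, h.ne', h0]
  rw [Matrix.det_mul, hT, ← pow_mul, ← pow_mul, mul_comm (p - 1)] at hdet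
  exact mul_right_cancel₀ (pow_ne_zero _ X_ne_zero) hdet

/-- Reorders the vertices so that the three arms come first. -/
def armsFirst (a b c : ℕ) :
    ((Fin a ⊕ Fin b) ⊕ Fin c) ⊕ (Fin 1 ⊕ Fin 1) ≃
      Fin 1 ⊕ ((Fin a ⊕ Fin b) ⊕ (Fin c ⊕ Fin 1)) where
  toFun := Sum.elim
    (Sum.elim (fun i => Sum.inr (Sum.inl i)) (fun i => Sum.inr (Sum.inr (Sum.inl i))))
    (Sum.elim Sum.inl (fun i => Sum.inr (Sum.inr (Sum.inr i))))
  invFun := Sum.elim (fun i => Sum.inr (Sum.inl i))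
    (Sum.elim (fun i => Sum.inl (Sum.inl i))
      (Sum.elim (fun i => Sum.inl (Sum.inr i)) (fun i => Sum.inr (Sum.inr i))))
  left_inv := by rintro ((_ | _) | (_ | _)) <;> rfl
  right_inv := by rintro (_ | (_ | (_ | _))) <;> rfl

/-- A function on the disjoint union of the three arms. -/
noncomputable def onArms {a b c : ℕ} (f : ∀ p : ℕ, Fin p → ℤ[X]) : (Fin a ⊕ Fin b) ⊕ Fin c → ℤ[X] :=
  Sum.elim (Sum.elim (f a) (f b)) (f c)

/-- The indicator of the arm vertices next to the centre. -/
noncomputable def armStart {a b c : ℕ} : (Fin a ⊕ Fin b) ⊕ Fin c → ℤ[X] :=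
  onArms fun _ i => if (i : ℕ) = 0 then 1 else 0

/-- The rows of the extension vertex and of the centre, restricted to the arms. -/
noncomputable def armRows (a b c : ℕ) : Matrix (Fin 1 ⊕ Fin 1) ((Fin a ⊕ Fin b) ⊕ Fin c) ℤ[X] :=
  Matrix.of (Sum.elim (fun _ => onArms fun p i => 1 - if (i : ℕ) = p - 1 then 1 else 0)
    (fun _ _ => 1))

/-- The columns of the extension vertex and of the centre, restricted to the arms. -/
noncomputable def armCols (a b c : ℕ) : Matrix ((Fin a ⊕ Fin b) ⊕ Fin c) (Fin 1 ⊕ Fin 1) ℤ[X] :=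
  Matrix.of fun i => Sum.elim (fun _ => armStart i) (fun _ => X * armStart i)

/-- The block of the extension vertex and the centre. -/
noncomputable def hubBlock : Matrix (Fin 1 ⊕ Fin 1) (Fin 1 ⊕ Fin 1) ℤ[X] :=
  Matrix.fromBlocks (Matrix.of fun _ _ => X) (Matrix.of fun _ _ => 1)
    (Matrix.of fun _ _ => 2) (Matrix.of fun _ _ => X + 1)

/-- The block diagonal matrix of the three arms. -/
noncomputable def armBlocks (a b c : ℕ) :
    Matrix ((Fin a ⊕ Fin b) ⊕ Fin c) ((Fin a ⊕ Fin b) ⊕ Fin c) ℤ[X] :=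
  Matrix.fromBlocks (Matrix.fromBlocks (armMatrix a) 0 0 (armMatrix b)) 0 0 (armMatrix c)

theorem charpoly_canonicalCoxeter_eq_det (a b c : ℕ) :
    (canonicalCoxeter a b c).charpoly =
      (Matrix.fromBlocks (armBlocks a b c) (armCols a b c) (armRows a b c) hubBlock).det := by
  let P : Matrix ((Fin a ⊕ Fin b) ⊕ Fin c) (Fin 1 ⊕ Fin 1) ℤ[X] :=
    Matrix.of fun i => Sum.elim 0 fun _ => armStart i
  have h : Matrix.fromBlocks 1 P 0 1 *
      (canonicalCoxeter a b c).charmatrix.submatrix (armsFirst a b c) (armsFirst a b c) =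
      Matrix.fromBlocks (armBlocks a b c) (armCols a b c) (armRows a b c) hubBlock := by
    rw [← Matrix.fromBlocks_toBlocks ((canonicalCoxeter a b c).charmatrix.submatrix _ _),
      Matrix.fromBlocks_multiply]
    simp only [Matrix.one_mul, Matrix.zero_mul, zero_add]
    congr 1
    · ext1 i j
      rcases i with ((i | i) | i) <;> rcases j with ((j | j) | j) <;>
      simp [P, Matrix.mul_apply, Matrix.toBlocks₁₁, Matrix.toBlocks₂₁, armsFirst,
        Matrix.charmatrix_apply, Matrix.diagonal_apply, canonicalCoxeter, starCoxeter, Jmat, Kmat,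
        armBlocks, armMatrix, armStart, onArms]
    · ext1 i j
      rcases i with ((i | i) | i) <;> rcases j with (j | j) <;> rw [Subsingleton.elim j 0] <;>
      simp [P, Matrix.mul_apply, Matrix.toBlocks₁₂, Matrix.toBlocks₂₂, armsFirst,
        Matrix.charmatrix_apply, Matrix.diagonal_apply, canonicalCoxeter, starCoxeter, Kmat,
        armCols, armStart, onArms] <;>
      split_ifs <;> ring
    · ext1 i j
      rcases i with (i | i) <;> rcases j with ((j | j) | j) <;>
      simp [Matrix.toBlocks₂₁, armsFirst,
        Matrix.charmatrix_apply, Matrix.diagonal_apply, canonicalCoxeter, starCoxeter, Kmat,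
        armRows, onArms]
    · ext1 i j
      rcases i with (i | i) <;> rcases j with (j | j) <;>
      simp [Matrix.toBlocks₂₂, armsFirst, Subsingleton.elim i j,
        Matrix.charmatrix_apply, Matrix.diagonal_apply, canonicalCoxeter, starCoxeter, Kmat,
        hubBlock]
  rw [← h, Matrix.det_mul, Matrix.det_fromBlocks_zero₂₁, Matrix.det_submatrix_equiv_self,
    Matrix.charpoly]
  simp

theorem charpoly_canonicalCoxeter {a b c : ℕ} (ha : 0 < a) (hb : 0 < b) (hc : 0 < c) :
    (canonicalCoxeter a b c).charpoly =
      (X - 1) ^ 2 * ((∑ j ∈ range (a + 1), X ^ j) * (∑ j ∈ range (b + 1), X ^ j) *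
        ∑ j ∈ range (c + 1), X ^ j) := by
  set da : ℤ[X] := ∑ j ∈ range (a + 1), X ^ j with hda
  set db : ℤ[X] := ∑ j ∈ range (b + 1), X ^ j with hdb
  set dc : ℤ[X] := ∑ j ∈ range (c + 1), X ^ j with hdc
  let w : (Fin a ⊕ Fin b) ⊕ Fin c → ℤ[X] :=
    Sum.elim (Sum.elim (fun i => db * dc * X ^ (a - 1 - (i : ℕ)))
      (fun i => da * dc * X ^ (b - 1 - (i : ℕ)))) (fun i => da * db * X ^ (c - 1 - (i : ℕ)))
  let U : Matrix ((Fin a ⊕ Fin b) ⊕ Fin c) (Fin 1 ⊕ Fin 1) ℤ[X] :=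
    Matrix.of fun i => Sum.elim (fun _ => w i) (fun _ => X * w i)
  have hw : armBlocks a b c *ᵥ w = (da * db * dc) • armStart := by
    ext1 i
    rcases i with ((i | i) | i) <;>
    simp [Matrix.mulVec, dotProduct, armBlocks, w, armStart, onArms, mul_left_comm (armMatrix _ _ _),
      ← Finset.mul_sum, armMatrix_mul_pow, ← hda, ← hdb, ← hdc] <;> grind
  have hU : armBlocks a b c * U = (da * db * dc) • armCols a b c := by
    ext1 i j
    have := congrFun hw i
    simp only [Matrix.mulVec, dotProduct, Pi.smul_apply, smul_eq_mul] at this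
    rcases j with (j | j)
    · simpa [Matrix.mul_apply, U, armCols] using this
    · simp only [Matrix.mul_apply, U, armCols, Matrix.of_apply, Sum.elim_inr, Matrix.smul_apply,
        smul_eq_mul, mul_left_comm _ X, ← Finset.mul_sum, this]
  have hrow₀ (k : Fin 1) : ∑ i, armRows a b c (Sum.inl k) i * w i =
      db * dc * (∑ j ∈ range a, X ^ j - 1) + da * dc * (∑ j ∈ range b, X ^ j - 1) +
        da * db * (∑ j ∈ range c, X ^ j - 1) := by
    simp only [Fintype.sum_sum_type, armRows, onArms, w, Matrix.of_apply, Sum.elim_inl,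
      Sum.elim_inr, sum_last_mul_pow, ha, hb, hc]
  have hrow₁ (k : Fin 1) : ∑ i, armRows a b c (Sum.inr k) i * w i =
      db * dc * (∑ j ∈ range a, X ^ j) + da * dc * (∑ j ∈ range b, X ^ j) +
        da * db * (∑ j ∈ range c, X ^ j) := by
    simp only [Fintype.sum_sum_type, armRows, w, Matrix.of_apply, Sum.elim_inl,
      Sum.elim_inr, one_mul, ← Finset.mul_sum, sum_pow_rev]
  have hschur : ((da * db * dc) • hubBlock - armRows a b c * U).det =
      (X - 1) ^ 2 * (da * db * dc) ^ 2 := by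
    rw [← Matrix.det_submatrix_equiv_self finSumFinEquiv.symm, Matrix.det_fin_two]
    have e0 : (finSumFinEquiv (m := 1) (n := 1)).symm 0 = Sum.inl 0 := rfl
    have e1 : (finSumFinEquiv (m := 1) (n := 1)).symm 1 = Sum.inr 0 := rfl
    simp only [Matrix.submatrix_apply, e0, e1, Matrix.sub_apply, Matrix.smul_apply, smul_eq_mul,
      Matrix.mul_apply, U, Matrix.of_apply, Sum.elim_inl, Sum.elim_inr, mul_left_comm _ X,
      ← Finset.mul_sum, hrow₀, hrow₁, hubBlock, Matrix.fromBlocks_apply₁₁,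
      Matrix.fromBlocks_apply₁₂, Matrix.fromBlocks_apply₂₁, Matrix.fromBlocks_apply₂₂]
    rw [hda, hdb, hdc, geom_sum_succ, geom_sum_succ, geom_sum_succ]
    ring
  have hne (p : ℕ) : (∑ j ∈ range (p + 1), (X : ℤ[X]) ^ j) ≠ 0 := by
    intro h
    simpa [eval_finsetSum, Nat.cast_add_one_ne_zero] using congrArg (eval 1) h
  have hblocks : (armBlocks a b c).det = da * db * dc := by
    rw [armBlocks, Matrix.det_fromBlocks_zero₂₁, Matrix.det_fromBlocks_zero₂₁, det_armMatrix ha,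
      det_armMatrix hb, det_armMatrix hc]
  have hdet := Matrix.det_fromBlocks_mul_pow _ _ (armRows a b c) hubBlock U _ hU
  rw [hschur, hblocks, ← charpoly_canonicalCoxeter_eq_det, ← mul_assoc] at hdet
  have hd : da * db * dc ≠ 0 := mul_ne_zero (mul_ne_zero (hne a) (hne b)) (hne c)
  rw [mul_comm ((X - 1) ^ 2)]
  exact mul_right_cancel₀ (pow_ne_zero 2 hd) (by simpa using hdet)

theorem coeff_eq_coeff_succ_add (f : ℤ[X]) (k : ℕ) :
    f.coeff k = f.coeff (k + 1) + ((X - 1) * f).coeff (k + 1) := by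
  rw [sub_mul, one_mul, coeff_sub, coeff_X_mul]
  ring

theorem X_sub_one_mul_charpoly_canonicalCoxeter {a b c : ℕ} (ha : 0 < a) (hb : 0 < b)
    (hc : 0 < c) :
    (X - 1) * (canonicalCoxeter a b c).charpoly =
      X ^ (a + b + c + 3) - X ^ (a + b + 2) - X ^ (a + c + 2) - X ^ (b + c + 2) +
        X ^ (a + 1) + X ^ (b + 1) + X ^ (c + 1) - 1 := by
  have hg (p : ℕ) : (∑ j ∈ range (p + 1), (X : ℤ[X]) ^ j) * (X - 1) = X ^ (p + 1) - 1 :=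
    geom_sum_mul _ _
  calc
    _ = ((∑ j ∈ range (a + 1), X ^ j) * (X - 1 : ℤ[X])) *
        ((∑ j ∈ range (b + 1), X ^ j) * (X - 1 : ℤ[X])) *
        ((∑ j ∈ range (c + 1), X ^ j) * (X - 1 : ℤ[X])) := by
      rw [charpoly_canonicalCoxeter ha hb hc]
      ring
    _ = _ := by
      rw [hg, hg, hg]
      ring

/-- Coefficients of the Coxeter polynomial of the canonical algebra `C_{a,b,c}`,
`2 ≤ a ≤ b ≤ c`: with `n = a + b + c + 1` and `det(x·I − Φ) = Σ_i λ_i x^i`,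
`λ_{n−r} = 1` for `1 ≤ r ≤ a − 1`, and `λ_{n−a} = −δ_{ab} − δ_{ac} ≤ 0`. -/
theorem coeff_coxeterPolynomial_canonical (a b c : ℕ) (ha : 2 ≤ a) (hab : a ≤ b)
    (hbc : b ≤ c) (n : ℕ) (hn : n = a + b + c + 1) :
    (∀ r : ℕ, 1 ≤ r → r ≤ a - 1 →
      (Matrix.charpoly (canonicalCoxeter a b c)).coeff (n - r) = 1) ∧
    (Matrix.charpoly (canonicalCoxeter a b c)).coeff (n - a) =
      -(if a = b then 1 else 0) - (if a = c then 1 else 0) ∧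
    (Matrix.charpoly (canonicalCoxeter a b c)).coeff (n - a) ≤ 0 := by
  have hstep := coeff_eq_coeff_succ_add (canonicalCoxeter a b c).charpoly
  rw [X_sub_one_mul_charpoly_canonicalCoxeter (by omega) (by omega) (by omega)] at hstep
  simp only [coeff_add, coeff_sub, coeff_X_pow, coeff_one] at hstep
  have htop : (canonicalCoxeter a b c).charpoly.coeff (n + 1) = 1 := by
    have hmonic := (canonicalCoxeter a b c).charpoly_monic.coeff_natDegree
    rw [Matrix.charpoly_natDegree_eq_dim] at hmonic
    convert hmonic using 2
    simp
    omega
  have hconst (r : ℕ) (hr : r ≤ a - 1) : (canonicalCoxeter a b c).charpoly.coeff (n - r) =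
      (canonicalCoxeter a b c).charpoly.coeff (n - r + 1) := by
    have hk : n - r + 1 ≠ a + b + c + 3 ∧ n - r + 1 ≠ a + b + 2 ∧ n - r + 1 ≠ a + c + 2 ∧
        n - r + 1 ≠ b + c + 2 ∧ n - r + 1 ≠ a + 1 ∧ n - r + 1 ≠ b + 1 ∧ n - r + 1 ≠ c + 1 := by
      omega
    rw [hstep]
    simp only [hk, if_false, Nat.succ_ne_zero, sub_zero, add_zero]
  have hlow (r : ℕ) (hr : r ≤ a - 1) :
      (canonicalCoxeter a b c).charpoly.coeff (n - r) = 1 := by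
    induction r with
    | zero => rw [hconst 0 hr, Nat.sub_zero, htop]
    | succ r ih =>
      rw [hconst (r + 1) hr, show n - (r + 1) + 1 = n - r by omega, ih (by omega)]
  have hcoeff : (canonicalCoxeter a b c).charpoly.coeff (n - a) =
      -(if a = b then 1 else 0) - (if a = c then 1 else 0) := by
    rw [hstep, show n - a + 1 = n - (a - 1) by omega, hlow _ le_rfl,
      show n - (a - 1) = b + c + 2 by omega]
    simp only [show b + c + 2 ≠ a + b + c + 3 by omega, show b + c + 2 ≠ a + 1 by omega,
      show b + c + 2 ≠ b + 1 by omega, show b + c + 2 ≠ c + 1 by omega, Nat.succ_ne_zero,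
      show b + c + 2 = a + b + 2 ↔ a = c by omega, show b + c + 2 = a + c + 2 ↔ a = b by omega,
      if_true, if_false]
    ring
  refine ⟨fun r _ hr => hlow r hr, hcoeff, ?_⟩
  rw [hcoeff]
  split_ifs <;> norm_num
end
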